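/- The solvability set is connected: if s₁, s₂ ∈ I(p₀) with s₁ < s₂, then every s with s₁ < s < s₂ also belongs to I(p₀). Hence I(p₀) is an interval. -/

import Mathlib

open Real Set MeasureTheory

/-- The relativistic operator `φ(v) = v / √(1 - v²/c²)`. -/
noncomputable def phi (c v : ℝ) : ℝ := v / Real.sqrt (1 - v ^ 2 / c ^ 2)

/-- `x` is a `T`-periodic solution of the relativistic pendulum equation
`(φ(x'))' + a x' + b sin x = p`. -/
def IsPendSol (c a b T : ℝ) (p x : ℝ → ℝ) : Prop :=
  Function.Periodic x T ∧
  ContDiff ℝ 1 x ∧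
  (∀ t : ℝ, |deriv x t| < c) ∧
  ContDiff ℝ 1 (fun t : ℝ => phi c (deriv x t)) ∧
  ∀ t : ℝ, deriv (fun τ : ℝ => phi c (deriv x τ)) t + a * deriv x t + b * Real.sin (x t) = p t

/-- The solvability set `I(p₀)`: the values `s` for which the relativistic pendulum
equation with forcing `p₀ + s` has a `T`-periodic solution. -/
def solvSet (c a b T : ℝ) (p₀ : ℝ → ℝ) : Set ℝ :=
  {s : ℝ | ∃ x : ℝ → ℝ, IsPendSol c a b T (fun t => p₀ t + s) x}
open Filter Topology

/-- The inverse of the relativistic operator. -/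
noncomputable def psi (c u : ℝ) : ℝ := u / Real.sqrt (1 + u ^ 2 / c ^ 2)

lemma psi_q_pos (c u : ℝ) : 0 < 1 + u ^ 2 / c ^ 2 := by positivity

lemma psi_abs_lt {c : ℝ} (hc : 0 < c) (u : ℝ) : |psi c u| < c := by
  unfold psi
  have h := psi_q_pos c u
  rw [abs_div, abs_of_pos (Real.sqrt_pos.2 h), div_lt_iff₀ (Real.sqrt_pos.2 h)]
  apply lt_of_pow_lt_pow_left₀ 2 (by positivity)
  rw [mul_pow, Real.sq_sqrt h.le, sq_abs]
  field_simp
  nlinarith [sq_pos_of_pos hc]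

lemma phi_psi {c : ℝ} (hc : 0 < c) (u : ℝ) : phi c (psi c u) = u := by
  unfold phi psi
  have h := psi_q_pos c u
  have h1 : 1 - (u / √(1 + u ^ 2 / c ^ 2)) ^ 2 / c ^ 2 = (1 + u ^ 2 / c ^ 2)⁻¹ := by
    rw [div_pow, Real.sq_sqrt h.le]
    field_simp
    ring
  rw [h1, Real.sqrt_inv]
  have := Real.sqrt_pos.2 h
  field_simp

lemma psi_phi {c : ℝ} (hc : 0 < c) {v : ℝ} (hv : |v| < c) : psi c (phi c v) = v := by
  unfold phi psi
  have h : 0 < 1 - v ^ 2 / c ^ 2 := by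
    have := sq_lt_sq' (abs_lt.1 hv).1 (abs_lt.1 hv).2
    rw [sub_pos, div_lt_one (by positivity)]
    exact this
  have h1 : 1 + (v / √(1 - v ^ 2 / c ^ 2)) ^ 2 / c ^ 2 = (1 - v ^ 2 / c ^ 2)⁻¹ := by
    rw [div_pow, Real.sq_sqrt h.le]
    have h2 : v ^ 2 = (1 - (1 - v ^ 2 / c ^ 2)) * c ^ 2 := by field_simp; ring
    generalize 1 - v ^ 2 / c ^ 2 = q at *
    rw [h2]
    field_simp
    ring
  rw [h1, Real.sqrt_inv]
  have := Real.sqrt_pos.2 h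
  generalize √(1 - v ^ 2 / c ^ 2) = q at *
  field_simp

lemma psi_hasDerivAt (c u : ℝ) :
    HasDerivAt (psi c) (1 / (√(1 + u ^ 2 / c ^ 2)) ^ 3) u := by
  have h := psi_q_pos c u
  have hs := Real.sqrt_pos.2 h
  have h1 : HasDerivAt (fun u : ℝ => 1 + u ^ 2 / c ^ 2) (2 * u / c ^ 2) u := by
    have := ((hasDerivAt_pow 2 u).div_const (c ^ 2)).const_add 1
    simpa using this
  have h2 := (hasDerivAt_id u).div (h1.sqrt h.ne') hs.ne'
  unfold psi
  refine h2.congr_deriv ?_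
  have h3 : √(1 + u ^ 2 / c ^ 2) ^ 2 = 1 + u ^ 2 / c ^ 2 := Real.sq_sqrt h.le
  simp only [id]
  generalize √(1 + u ^ 2 / c ^ 2) = q at *
  rw [div_eq_div_iff (by positivity) (by positivity)]
  have : (1 * q - u * (2 * u / c ^ 2 / (2 * q))) * q = 1 := by
    field_simp
    rw [h3]
    ring
  linear_combination q ^ 2 * this

lemma psi_strictMono (c : ℝ) : StrictMono (psi c) := by
  apply strictMono_of_deriv_pos
  intro u
  rw [(psi_hasDerivAt c u).deriv]
  have := Real.sqrt_pos.2 (psi_q_pos c u)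
  positivity

lemma psi_lipschitz (c : ℝ) : LipschitzWith 1 (psi c) := by
  apply lipschitzWith_of_nnnorm_deriv_le (fun u => (psi_hasDerivAt c u).differentiableAt)
  intro u
  rw [(psi_hasDerivAt c u).deriv, ← NNReal.coe_le_coe, coe_nnnorm, Real.norm_eq_abs]
  have h1 : 1 ≤ √(1 + u ^ 2 / c ^ 2) := by
    rw [Real.one_le_sqrt]
    have : 0 ≤ u ^ 2 / c ^ 2 := by positivity
    linarith
  rw [abs_of_nonneg (by positivity)]
  rw [NNReal.coe_one, div_le_one (by positivity)]
  exact one_le_pow₀ h1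

lemma psi_zero (c : ℝ) : psi c 0 = 0 := by simp [psi]

lemma flow_exists {f : ℝ → ℝ × ℝ → ℝ × ℝ} {K : NNReal} (hK : ∀ t, LipschitzWith K (f t))
    (hf : ∀ z, Continuous (fun t => f t z)) {L : NNReal} (hL : ∀ t z, ‖f t z‖ ≤ L)
    {T : ℝ} (hT : 0 < T) (z : ℝ × ℝ) :
    ∃ α : ℝ → ℝ × ℝ, α 0 = z ∧ ∀ t ∈ Ioo (-1 : ℝ) (T + 1), HasDerivAt α (f t (α t)) t := by
  let t₀ : Icc (-1 : ℝ) (T + 1) := ⟨0, by constructor <;> linarith⟩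
  have hPL : IsPicardLindelof f t₀ z (L * ⟨T + 1, by linarith⟩) 0 L K := by
    refine ⟨fun t _ => (hK t).lipschitzOnWith, fun x _ => (hf x).continuousOn,
      fun t _ x _ => hL t x, ?_⟩
    have : max (T + 1 - (t₀ : ℝ)) ((t₀ : ℝ) - (-1)) = T + 1 := by
      simp only [t₀]
      rw [max_eq_left] <;> linarith
    rw [this]
    simp
    rfl
  obtain ⟨α, h0, hα⟩ := hPL.exists_eq_forall_mem_Icc_hasDerivWithinAt₀
  exact ⟨α, h0, fun t ht => (hα t ⟨ht.1.le, ht.2.le⟩).hasDerivAt (Icc_mem_nhds ht.1 ht.2)⟩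

/-- Strict comparison in the second initial coordinate for a cooperative planar system. -/
lemma ode_compare {ψ g h : ℝ → ℝ} (hψ : StrictMono ψ) (hg : Monotone g) {a T : ℝ} (hT : 0 < T)
    {X Y Z W : ℝ → ℝ}
    (hX : ∀ t ∈ Ioo (-1 : ℝ) (T + 1), HasDerivAt X (ψ (Y t - a * X t)) t)
    (hY : ∀ t ∈ Ioo (-1 : ℝ) (T + 1), HasDerivAt Y (h t + g (X t)) t)
    (hZ : ∀ t ∈ Ioo (-1 : ℝ) (T + 1), HasDerivAt Z (ψ (W t - a * Z t)) t)
    (hW : ∀ t ∈ Ioo (-1 : ℝ) (T + 1), HasDerivAt W (h t + g (Z t)) t)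
    (h0 : X 0 = Z 0) (h1 : Y 0 < W 0) : X T < Z T := by
  -- first step: as long as `W > Y` we have `Z ≥ X`
  have step : ∀ t₁, t₁ < T + 1 → (∀ t ∈ Ico 0 t₁, Y t < W t) → ∀ t ∈ Icc 0 t₁, X t ≤ Z t := by
    intro t₁ ht₁ hlt
    refine image_le_of_deriv_right_lt_deriv_boundary'
      (f' := fun t => ψ (Y t - a * X t)) (B' := fun t => ψ (W t - a * Z t)) ?_ ?_ h0.le ?_ ?_ ?_
    · intro t ht
      exact (hX t ⟨by linarith [ht.1], by linarith [ht.2]⟩).continuousAt.continuousWithinAt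
    · intro t ht
      exact (hX t ⟨by linarith [ht.1], by linarith [ht.2]⟩).hasDerivWithinAt
    · intro t ht
      exact (hZ t ⟨by linarith [ht.1], by linarith [ht.2]⟩).continuousAt.continuousWithinAt
    · intro t ht
      exact (hZ t ⟨by linarith [ht.1], by linarith [ht.2]⟩).hasDerivWithinAt
    · intro t ht he
      apply hψ
      rw [he]
      linarith [hlt t ht]
  have key : ∀ t ∈ Icc 0 (T + 1 / 2), Y t < W t := by
    by_contra! hcon
    set S : Set ℝ := Icc 0 (T + 1 / 2) ∩ (fun t => W t - Y t) ⁻¹' (Iic 0) with hS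
    have hcont : ContinuousOn (fun t => W t - Y t) (Icc 0 (T + 1 / 2)) := by
      intro t ht
      have ht' : t ∈ Ioo (-1 : ℝ) (T + 1) := ⟨by linarith [ht.1], by linarith [ht.2]⟩
      exact ((hW t ht').continuousAt.sub (hY t ht').continuousAt).continuousWithinAt
    have hcl : IsClosed S := hcont.preimage_isClosed_of_isClosed isClosed_Icc isClosed_Iic
    have hcomp : IsCompact S := isCompact_Icc.of_isClosed_subset hcl inter_subset_left
    have hne : S.Nonempty := by
      obtain ⟨t, ht, h⟩ := hcon
      exact ⟨t, ht, by simpa using h⟩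
    obtain ⟨t₁, ht₁, hmin⟩ := hcomp.exists_isLeast hne
    have hlt : ∀ t ∈ Ico 0 t₁, Y t < W t := by
      intro t ht
      by_contra! hh
      have : t ∈ S := ⟨⟨ht.1, by linarith [ht.2, ht₁.1.2]⟩, by simpa using hh⟩
      linarith [hmin this, ht.2]
    have hle := step t₁ (by linarith [ht₁.1.2]) hlt
    have hmono : MonotoneOn (fun t => W t - Y t) (Icc 0 t₁) := by
      apply monotoneOn_of_deriv_nonneg (convex_Icc 0 t₁)
      · exact hcont.mono (Icc_subset_Icc_right ht₁.1.2)
      · intro t ht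
        rw [interior_Icc] at ht
        have ht' : t ∈ Ioo (-1 : ℝ) (T + 1) :=
          ⟨by linarith [ht.1], by linarith [ht.2, ht₁.1.2]⟩
        exact ((hW t ht').sub (hY t ht')).differentiableAt.differentiableWithinAt
      · intro t ht
        rw [interior_Icc] at ht
        have ht' : t ∈ Ioo (-1 : ℝ) (T + 1) :=
          ⟨by linarith [ht.1], by linarith [ht.2, ht₁.1.2]⟩
        have hd := ((hW t ht').sub (hY t ht')).deriv
        have hd' : deriv (fun t => W t - Y t) t = h t + g (Z t) - (h t + g (X t)) := hd
        rw [hd']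
        linarith [hg (hle t ⟨ht.1.le, ht.2.le⟩)]
    have h2 := hmono ⟨le_rfl, ht₁.1.1⟩ ⟨ht₁.1.1, le_rfl⟩ ht₁.1.1
    have h3 : W t₁ - Y t₁ ≤ 0 := ht₁.2
    linarith
  have hle := step (T + 1 / 2) (by linarith) (fun t ht => key t ⟨ht.1, ht.2.le⟩)
  have hTm : T ∈ Ioo (-1 : ℝ) (T + 1) := ⟨by linarith, by linarith⟩
  refine lt_of_le_of_ne (hle T ⟨hT.le, by linarith⟩) fun he => ?_
  have hmin : IsLocalMin (fun t => Z t - X t) T := by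
    filter_upwards [Icc_mem_nhds hT (show T < T + 1 / 2 by linarith)] with t ht
    have := hle t ht
    linarith
  have hd := hmin.hasDerivAt_eq_zero ((hZ T hTm).sub (hX T hTm))
  have h5 : W T - a * Z T = Y T - a * X T := hψ.injective (by linarith)
  have := key T ⟨hT.le, by linarith⟩
  rw [he] at h5
  linarith

lemma mvt_bound {f f' : ℝ → ℝ} {C T : ℝ} (hC : 0 ≤ C)
    (hf : ∀ t ∈ Icc 0 T, HasDerivAt f (f' t) t) (hb : ∀ t ∈ Icc 0 T, |f' t| ≤ C) :
    ∀ t ∈ Icc 0 T, |f t - f 0| ≤ C * T := by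
  intro t ht
  have := norm_image_sub_le_of_norm_deriv_le_segment' (f := f) (f' := f') (C := C)
    (fun x hx => (hf x hx).hasDerivWithinAt) (fun x hx => hb x ⟨hx.1, hx.2.le⟩) t ht
  rw [Real.norm_eq_abs] at this
  nlinarith [ht.2]

lemma strict_inc {f f' : ℝ → ℝ} {T : ℝ} (hT : 0 < T)
    (hf : ∀ t ∈ Icc 0 T, HasDerivAt f (f' t) t) (hb : ∀ t ∈ Icc 0 T, 0 < f' t) :
    f 0 < f T := by
  have : StrictMonoOn f (Icc 0 T) := by
    apply strictMonoOn_of_deriv_pos (convex_Icc 0 T)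
    · exact fun t ht => (hf t ht).continuousAt.continuousWithinAt
    · intro t ht
      rw [interior_Icc] at ht
      rw [(hf t ⟨ht.1.le, ht.2.le⟩).deriv]
      exact hb t ⟨ht.1.le, ht.2.le⟩
  exact this ⟨le_rfl, hT.le⟩ ⟨hT.le, le_rfl⟩ hT

lemma strict_dec {f f' : ℝ → ℝ} {T : ℝ} (hT : 0 < T)
    (hf : ∀ t ∈ Icc 0 T, HasDerivAt f (f' t) t) (hb : ∀ t ∈ Icc 0 T, f' t < 0) :
    f T < f 0 := by
  have := strict_inc (f := fun t => - f t) (f' := fun t => - f' t) hT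
    (fun t ht => (hf t ht).neg) (fun t ht => by linarith [hb t ht])
  linarith

lemma clamp_lip (M x y : ℝ) : |max (-M) (min x M) - max (-M) (min y M)| ≤ |x - y| := by
  refine (abs_max_sub_max_le_max _ _ _ _).trans ?_
  simp only [sub_self, abs_zero]
  refine max_le (abs_nonneg _) ?_
  refine (abs_min_sub_min_le_max _ _ _ _).trans ?_
  simp

lemma clamp_bound {M : ℝ} (hM : 0 ≤ M) (x : ℝ) : |max (-M) (min x M)| ≤ M := by
  rw [abs_le]
  exact ⟨le_max_left _ _, max_le (by linarith) (min_le_right _ _)⟩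

lemma clamp_eq {M x : ℝ} (hx : |x| ≤ M) : max (-M) (min x M) = x := by
  rw [abs_le] at hx
  rw [min_eq_left hx.2, max_eq_right hx.1]

/-- Solvability of the periodic boundary value problem by two-step shooting. -/
lemma periodic_bvp {ψ : ℝ → ℝ} (hψ : StrictMono ψ) (hψ0 : ψ 0 = 0) (hlip : LipschitzWith 1 ψ)
    {c a K T H : ℝ} (hc : 0 < c) (hψc : ∀ u, |ψ u| ≤ c) (ha : 0 < a) (hK : 0 < K) (hT : 0 < T)
    {h : ℝ → ℝ} (hh : Continuous h) (hH : ∀ t, |h t| ≤ H) :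
    ∃ X Y : ℝ → ℝ, X T = X 0 ∧ Y T = Y 0 ∧
      (∀ t ∈ Icc 0 T, HasDerivAt X (ψ (Y t - a * X t)) t) ∧
      (∀ t ∈ Icc 0 T, HasDerivAt Y (h t + K * X t) t) := by
  have hH0 : 0 ≤ H := (abs_nonneg _).trans (hH 0)
  have hcT : 0 < c * T := by positivity
  obtain ⟨R, hR⟩ : ∃ R, R = c * T + H / K + 1 := ⟨_, rfl⟩
  have hHK : 0 ≤ H / K := by positivity
  obtain ⟨M, hM⟩ : ∃ M, M = R + c * T := ⟨_, rfl⟩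
  have hM0 : 0 ≤ M := by linarith
  obtain ⟨g, hg⟩ : ∃ g : ℝ → ℝ, g = fun x => K * max (-M) (min x M) := ⟨_, rfl⟩
  have hgm : Monotone g := by
    intro x y hxy
    simp only [hg]
    gcongr
  have hgb : ∀ x, |g x| ≤ K * M := by
    intro x
    simp only [hg]
    rw [abs_mul, abs_of_pos hK]
    gcongr
    exact clamp_bound hM0 x
  have hgl : ∀ x y, |g x - g y| ≤ K * |x - y| := by
    intro x y
    simp only [hg]
    rw [← mul_sub, abs_mul, abs_of_pos hK]
    exact mul_le_mul_of_nonneg_left (clamp_lip M x y) hK.le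
  have hge : ∀ x, |x| ≤ M → g x = K * x := by
    intro x hx
    simp only [hg]
    rw [clamp_eq hx]
  let f : ℝ → ℝ × ℝ → ℝ × ℝ := fun t z => (ψ (z.2 - a * z.1), h t + g z.1)
  have hfl : ∀ t, LipschitzWith (Real.toNNReal (1 + a + K)) (f t) := by
    intro t
    apply LipschitzWith.of_dist_le_mul
    intro z w
    rw [Real.coe_toNNReal _ (by positivity)]
    have e1 : |z.1 - w.1| ≤ dist z w := by
      rw [← Real.dist_eq]; exact le_max_left _ _
    have e2 : |z.2 - w.2| ≤ dist z w := by
      rw [← Real.dist_eq]; exact le_max_right _ _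
    have e0 : 0 ≤ dist z w := dist_nonneg
    rw [Prod.dist_eq]
    refine max_le ?_ ?_
    · refine (hlip.dist_le_mul _ _).trans ?_
      rw [NNReal.coe_one, one_mul, Real.dist_eq]
      have : z.2 - a * z.1 - (w.2 - a * w.1) = (z.2 - w.2) - a * (z.1 - w.1) := by ring
      rw [this]
      refine (abs_sub _ _).trans ?_
      rw [abs_mul, abs_of_pos ha]
      nlinarith
    · rw [Real.dist_eq]
      have : (f t z).2 - (f t w).2 = g z.1 - g w.1 := by simp only [f]; ring
      rw [this]
      refine (hgl _ _).trans ?_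
      nlinarith
  have hfc : ∀ z, Continuous (fun t => f t z) := by
    intro z
    exact continuous_const.prodMk (hh.add continuous_const)
  obtain ⟨B, hB⟩ : ∃ B, B = H + K * M := ⟨_, rfl⟩
  have hKM : 0 ≤ K * M := by positivity
  have hB0 : 0 ≤ B := by linarith
  have hYb : ∀ t x, |h t + g x| ≤ B := fun t x =>
    (abs_add_le _ _).trans (by linarith [hH t, hgb x])
  have hfb : ∀ t z, ‖f t z‖ ≤ (Real.toNNReal (c + B) : ℝ) := by
    intro t z
    rw [Real.coe_toNNReal _ (by positivity), Prod.norm_def]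
    refine max_le ?_ ?_
    · rw [Real.norm_eq_abs]
      linarith [hψc (z.2 - a * z.1)]
    · rw [Real.norm_eq_abs]
      linarith [hYb t z.1]
  choose α hα0 hα using flow_exists hfl hfc hfb hT
  have hX : ∀ z, ∀ t ∈ Ioo (-1 : ℝ) (T + 1),
      HasDerivAt (fun t => (α z t).1) (ψ ((α z t).2 - a * (α z t).1)) t := fun z t ht =>
    (hasFDerivAt_fst (𝕜 := ℝ) (p := α z t)).comp_hasDerivAt t (hα z t ht)
  have hY : ∀ z, ∀ t ∈ Ioo (-1 : ℝ) (T + 1),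
      HasDerivAt (fun t => (α z t).2) (h t + g (α z t).1) t := fun z t ht =>
    (hasFDerivAt_snd (𝕜 := ℝ) (p := α z t)).comp_hasDerivAt t (hα z t ht)
  have hsub : ∀ t ∈ Icc 0 T, t ∈ Ioo (-1 : ℝ) (T + 1) := fun t ht =>
    ⟨by linarith [ht.1], by linarith [ht.2]⟩
  have hXi : ∀ z, (α z 0).1 = z.1 := fun z => by rw [hα0]
  have hYi : ∀ z, (α z 0).2 = z.2 := fun z => by rw [hα0]
  -- continuity of the time `T` map
  have hcont : Continuous (fun z => α z T) := by
    have : LipschitzWith (Real.toNNReal (Real.exp (Real.toNNReal (1 + a + K) * (T - 0))))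
        (fun z => α z T) := by
      apply LipschitzWith.of_dist_le_mul
      intro z w
      rw [Real.coe_toNNReal _ (Real.exp_pos _).le, mul_comm]
      refine dist_le_of_trajectories_ODE (v := f) (f := α z) (g := α w) (a := 0) (b := T) hfl
        ?_ ?_ ?_ ?_ ?_ T ⟨hT.le, le_rfl⟩
      · exact fun t ht => (hα z t (hsub t ht)).continuousAt.continuousWithinAt
      · exact fun t ht => (hα z t (hsub t ⟨ht.1, ht.2.le⟩)).hasDerivWithinAt
      · exact fun t ht => (hα w t (hsub t ht)).continuousAt.continuousWithinAt
      · exact fun t ht => (hα w t (hsub t ⟨ht.1, ht.2.le⟩)).hasDerivWithinAt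
      · rw [hα0, hα0]
    exact this.continuous
  have hXb : ∀ z, ∀ t ∈ Icc 0 T, |(α z t).1 - z.1| ≤ c * T := by
    intro z t ht
    have := mvt_bound hc.le (fun t ht => hX z t (hsub t ht)) (fun t _ => hψc _) t ht
    simpa only [hXi] using this
  have hYb' : ∀ z, ∀ t ∈ Icc 0 T, |(α z t).2 - z.2| ≤ B * T := by
    intro z t ht
    have := mvt_bound hB0 (fun t ht => hY z t (hsub t ht)) (fun t _ => hYb _ _) t ht
    simpa only [hYi] using this
  -- strict monotonicity in the second coordinate
  have hmono : ∀ ξ y₁ y₂, y₁ < y₂ → (α (ξ, y₁) T).1 < (α (ξ, y₂) T).1 := by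
    intro ξ y₁ y₂ hlt
    exact ode_compare (a := a) (h := h) hψ hgm hT (hX (ξ, y₁)) (hY (ξ, y₁)) (hX (ξ, y₂))
      (hY (ξ, y₂)) (by simp only [hXi]) (by simpa only [hYi] using hlt)
  -- existence of a root
  have hroot : ∀ ξ, ∃ η, (α (ξ, η) T).1 = ξ := by
    intro ξ
    obtain ⟨N, hN⟩ : ∃ N, N = B * T + a * (|ξ| + c * T) + 1 := ⟨_, rfl⟩
    have hBT : 0 ≤ B * T := by positivity
    have hN0 : 0 < N := by
      have : 0 ≤ a * (|ξ| + c * T) := by positivity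
      linarith
    have hXa : ∀ η, ∀ t ∈ Icc 0 T, |a * (α (ξ, η) t).1| ≤ a * (|ξ| + c * T) := by
      intro η t ht
      rw [abs_mul, abs_of_pos ha]
      gcongr
      have h1 := hXb (ξ, η) t ht
      have h2 := abs_add_le ((α (ξ, η) t).1 - ξ) ξ
      rw [sub_add_cancel] at h2
      simp only at h1
      linarith
    have hup : ξ < (α (ξ, N) T).1 := by
      have := strict_inc hT (fun t ht => hX (ξ, N) t (hsub t ht)) (fun t ht => by
        rw [← hψ0]
        apply hψ
        have h1 := abs_le.1 (hXa N t ht)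
        have h2 := abs_le.1 (hYb' (ξ, N) t ht)
        simp only at h2
        linarith [h1.2, h2.1])
      simpa only [hXi] using this
    have hdn : (α (ξ, -N) T).1 < ξ := by
      have := strict_dec hT (fun t ht => hX (ξ, -N) t (hsub t ht)) (fun t ht => by
        rw [← hψ0]
        apply hψ
        have h1 := abs_le.1 (hXa (-N) t ht)
        have h2 := abs_le.1 (hYb' (ξ, -N) t ht)
        simp only at h2
        linarith [h1.1, h2.2])
      simpa only [hXi] using this
    have hco : Continuous (fun η => (α (ξ, η) T).1) :=
      continuous_fst.comp (hcont.comp (continuous_const.prodMk continuous_id))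
    obtain ⟨η, _, hη⟩ := intermediate_value_Icc (show -N ≤ N by linarith) hco.continuousOn
      ⟨hdn.le, hup.le⟩
    exact ⟨η, hη⟩
  choose η hη using hroot
  have hηc : Continuous η := by
    rw [continuous_iff_continuousAt]
    intro ξ₀
    have hco : ∀ y, Continuous (fun ξ => (α (ξ, y) T).1 - ξ) := fun y =>
      (continuous_fst.comp (hcont.comp (continuous_id.prodMk continuous_const))).sub continuous_id
    have hlt : ∀ ξ y, (α (ξ, y) T).1 - ξ < 0 → y < η ξ := by
      intro ξ y hy
      by_contra! hle
      rcases hle.eq_or_lt with he | hl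
      · rw [← he, hη] at hy; linarith
      · have := hmono ξ _ _ hl
        rw [hη] at this; linarith
    have hgt : ∀ ξ y, 0 < (α (ξ, y) T).1 - ξ → η ξ < y := by
      intro ξ y hy
      by_contra! hle
      rcases hle.eq_or_lt with he | hl
      · rw [he, hη] at hy; linarith
      · have := hmono ξ _ _ hl
        rw [hη] at this; linarith
    rw [ContinuousAt, tendsto_order]
    constructor
    · intro y hy
      have h1 : (α (ξ₀, y) T).1 - ξ₀ < 0 := by
        have := hmono ξ₀ _ _ hy
        rw [hη] at this; linarith
      filter_upwards [(hco y).continuousAt.eventually (gt_mem_nhds h1)] with ξ hξ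
      exact hlt _ _ hξ
    · intro y hy
      have h1 : 0 < (α (ξ₀, y) T).1 - ξ₀ := by
        have := hmono ξ₀ _ _ hy
        rw [hη] at this; linarith
      filter_upwards [(hco y).continuousAt.eventually (lt_mem_nhds h1)] with ξ hξ
      exact hgt _ _ hξ
  have hGc : Continuous (fun ξ => (α (ξ, η ξ) T).2 - η ξ) :=
    (continuous_snd.comp (hcont.comp (continuous_id.prodMk hηc))).sub hηc
  have hXM : ∀ ξ, |ξ| ≤ R → ∀ y, ∀ t ∈ Icc 0 T, |(α (ξ, y) t).1| ≤ M := by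
    intro ξ hξ y t ht
    have h1 := hXb (ξ, y) t ht
    have h2 := abs_add_le ((α (ξ, y) t).1 - ξ) ξ
    rw [sub_add_cancel] at h2
    simp only at h1
    linarith
  have hR0 : 0 < R := by linarith
  have hKR : H < K * (R - c * T) := by
    rw [hR]
    have : K * (c * T + H / K + 1 - c * T) = H + K := by field_simp; ring
    rw [this]; linarith
  have hGup : 0 < (α (R, η R) T).2 - η R := by
    have := strict_inc hT (fun t ht => hY (R, η R) t (hsub t ht)) (fun t ht => by
      rw [hge _ (hXM R (abs_of_pos hR0).le _ t ht)]
      have h1 := abs_le.1 (hXb (R, η R) t ht)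
      have h2 := abs_le.1 (hH t)
      simp only at h1
      have h3 : K * (R - c * T) ≤ K * (α (R, η R) t).1 := by
        gcongr
        linarith [h1.1]
      linarith [h2.1])
    simp only [hYi] at this
    linarith
  have hGdn : (α (-R, η (-R)) T).2 - η (-R) < 0 := by
    have := strict_dec hT (fun t ht => hY (-R, η (-R)) t (hsub t ht)) (fun t ht => by
      rw [hge _ (hXM (-R) (by rw [abs_neg]; exact (abs_of_pos hR0).le) _ t ht)]
      have h1 := abs_le.1 (hXb (-R, η (-R)) t ht)
      have h2 := abs_le.1 (hH t)
      simp only at h1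
      have h3 : K * (α (-R, η (-R)) t).1 ≤ K * (-(R - c * T)) := by
        gcongr
        linarith [h1.2]
      linarith [h2.2])
    simp only [hYi] at this
    linarith
  obtain ⟨ξ, hξ, hξ0⟩ := intermediate_value_Icc (show -R ≤ R by linarith) hGc.continuousOn
    ⟨hGdn.le, hGup.le⟩
  refine ⟨fun t => (α (ξ, η ξ) t).1, fun t => (α (ξ, η ξ) t).2, ?_, ?_, ?_, ?_⟩
  · simp only [hη, hXi]
  · simp only [hYi]
    simp only at hξ0
    linarith
  · exact fun t ht => hX _ t (hsub t ht)
  · intro t ht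
    have := hY (ξ, η ξ) t (hsub t ht)
    rwa [hge _ (hXM ξ (abs_le.2 hξ) _ t ht)] at this

lemma periodic_extension {f : ℝ → ℝ} {T : ℝ} (hT : 0 < T) (hf : ContinuousOn f (Icc 0 T))
    (h : f T = f 0) :
    ∃ F : ℝ → ℝ, Continuous F ∧ Function.Periodic F T ∧ ∀ t ∈ Icc 0 T, F t = f t := by
  have : Fact (0 < T) := ⟨hT⟩
  have hc : Continuous (AddCircle.liftIco T 0 f) :=
    AddCircle.liftIco_continuous (by rw [zero_add]; exact h.symm) (by rwa [zero_add])
  have hper : Function.Periodic (fun t : ℝ => AddCircle.liftIco T 0 f (t : AddCircle T)) T := by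
    intro t
    simp only
    rw [AddCircle.coe_add_period]
  refine ⟨fun t => AddCircle.liftIco T 0 f (t : AddCircle T),
    hc.comp (AddCircle.continuous_mk' T), hper, ?_⟩
  have h0 : ∀ t ∈ Ico 0 T, AddCircle.liftIco T 0 f (t : AddCircle T) = f t := fun t ht =>
    AddCircle.liftIco_coe_apply (by rwa [zero_add])
  intro t ht
  rcases ht.2.eq_or_lt with he | hl
  · have h1 := hper 0
    simp only [zero_add] at h1
    simp only [he]
    rw [h1, h0 0 ⟨le_rfl, hT⟩, h]
  · exact h0 t ⟨ht.1, hl⟩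

lemma periodic_deriv {F G f : ℝ → ℝ} {T : ℝ} (hT : 0 < T) (hF : Function.Periodic F T)
    (hG : Function.Periodic G T) (hGc : Continuous G) (he : ∀ t ∈ Icc 0 T, F t = f t)
    (hf : ∀ t ∈ Icc 0 T, HasDerivAt f (G t) t) : ∀ t, HasDerivAt F (G t) t := by
  have hint : ∀ u v : ℝ, IntervalIntegrable G volume u v := fun u v => hGc.intervalIntegrable u v
  have h1 : ∀ t ∈ Icc 0 T, ∫ τ in (0 : ℝ)..t, G τ = F t - F 0 := by
    intro t ht
    rw [he t ht, he 0 ⟨le_rfl, hT.le⟩]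
    apply intervalIntegral.integral_eq_sub_of_hasDerivAt _ (hint _ _)
    intro τ hτ
    rw [uIcc_of_le ht.1] at hτ
    exact hf τ ⟨hτ.1, hτ.2.trans ht.2⟩
  have hz : ∫ τ in (0 : ℝ)..T, G τ = 0 := by
    rw [h1 T ⟨hT.le, le_rfl⟩]
    have := hF 0
    rw [zero_add] at this
    linarith
  have hJ : Function.Periodic (fun t => F t - ∫ τ in (0 : ℝ)..t, G τ) T := by
    intro t
    simp only
    rw [hF t, ← intervalIntegral.integral_add_adjacent_intervals (hint 0 t) (hint t (t + T)),
      hG.intervalIntegral_add_eq t 0, zero_add, hz, add_zero]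
  have hall : ∀ t, F t = F 0 + ∫ τ in (0 : ℝ)..t, G τ := by
    intro t
    obtain ⟨s, hs, hts⟩ := hJ.exists_mem_Ico₀ hT t
    have := h1 s ⟨hs.1, hs.2.le⟩
    linarith
  intro t
  have : F = fun t => F 0 + ∫ τ in (0 : ℝ)..t, G τ := funext hall
  rw [this]
  exact (hGc.integral_hasStrictDerivAt 0 t).hasDerivAt.const_add _

lemma periodic_bounded {f : ℝ → ℝ} {T : ℝ} (hT : 0 < T) (hf : Continuous f)
    (hp : Function.Periodic f T) : ∃ H, ∀ t, |f t| ≤ H := by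
  obtain ⟨H, hH⟩ := isCompact_Icc.exists_bound_of_continuousOn (s := Icc 0 T) hf.continuousOn
  refine ⟨H, fun t => ?_⟩
  obtain ⟨s, hs, hts⟩ := hp.exists_mem_Ico₀ hT t
  rw [hts]
  exact hH s ⟨hs.1, hs.2.le⟩

lemma periodic_exists_max {f : ℝ → ℝ} {T : ℝ} (hT : 0 < T) (hf : Continuous f)
    (hp : Function.Periodic f T) : ∃ t₀, ∀ t, f t ≤ f t₀ := by
  obtain ⟨t₀, _, h⟩ := isCompact_Icc.exists_isMaxOn (s := Icc 0 T) ⟨0, le_rfl, hT.le⟩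
    hf.continuousOn
  refine ⟨t₀, fun t => ?_⟩
  obtain ⟨s, hs, hts⟩ := hp.exists_mem_Ico₀ hT t
  rw [hts]
  exact h ⟨hs.1, hs.2.le⟩

lemma linv_exists {ψ : ℝ → ℝ} (hψ : StrictMono ψ) (hψ0 : ψ 0 = 0) (hlip : LipschitzWith 1 ψ)
    {c a K T : ℝ} (hc : 0 < c) (hψc : ∀ u, |ψ u| ≤ c) (ha : 0 < a) (hK : 0 < K) (hT : 0 < T)
    {h : ℝ → ℝ} (hh : Continuous h) (hp : Function.Periodic h T) :
    ∃ x y : ℝ → ℝ, Function.Periodic x T ∧ Function.Periodic y T ∧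
      (∀ t, HasDerivAt x (ψ (y t - a * x t)) t) ∧
      (∀ t, HasDerivAt y (h t + K * x t) t) := by
  obtain ⟨H, hH⟩ := periodic_bounded hT hh hp
  obtain ⟨X, Y, hX0, hY0, hX, hY⟩ := periodic_bvp hψ hψ0 hlip hc hψc ha hK hT hh hH
  obtain ⟨x, hxc, hxp, hx⟩ := periodic_extension hT
    (fun t ht => (hX t ht).continuousAt.continuousWithinAt) hX0
  obtain ⟨y, hyc, hyp, hy⟩ := periodic_extension hT
    (fun t ht => (hY t ht).continuousAt.continuousWithinAt) hY0
  refine ⟨x, y, hxp, hyp, ?_, ?_⟩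
  · refine periodic_deriv hT hxp (G := fun t => ψ (y t - a * x t)) ?_ ?_ hx ?_
    · intro t
      simp only [hyp t, hxp t]
    · exact hlip.continuous.comp (hyc.sub (hxc.const_mul a))
    · intro t ht
      simp only [hx t ht, hy t ht]
      exact hX t ht
  · refine periodic_deriv hT hyp (G := fun t => h t + K * x t) ?_ ?_ hy ?_
    · intro t
      simp only [hp t, hxp t]
    · exact hh.add (hxc.const_mul K)
    · intro t ht
      simp only [hx t ht]
      exact hY t ht

/-- Maximum principle. -/
lemma max_principle {ψ : ℝ → ℝ} (hψ : StrictMono ψ) {a K T : ℝ} (hK : 0 < K) (hT : 0 < T)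
    {h k x y z w : ℝ → ℝ} (hxp : Function.Periodic x T) (hzp : Function.Periodic z T)
    (hx : ∀ t, HasDerivAt x (ψ (y t - a * x t)) t)
    (hy : ∀ t, HasDerivAt y (h t + K * x t) t)
    (hz : ∀ t, HasDerivAt z (ψ (w t - a * z t)) t)
    (hw : ∀ t, HasDerivAt w (k t + K * z t) t)
    (hhk : ∀ t, k t ≤ h t) : ∀ t, x t ≤ z t := by
  have hDd : ∀ t, HasDerivAt (fun t => x t - z t) (ψ (y t - a * x t) - ψ (w t - a * z t)) t :=
    fun t => (hx t).sub (hz t)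
  have hDc : Continuous (fun t => x t - z t) :=
    continuous_iff_continuousAt.2 fun t => (hDd t).continuousAt
  obtain ⟨t₀, ht₀⟩ := periodic_exists_max hT hDc (by
    intro t
    simp only [hxp t, hzp t])
  by_contra! hcon
  obtain ⟨t₁, ht₁⟩ := hcon
  have hpos : 0 < x t₀ - z t₀ := by linarith [ht₀ t₁]
  have hmax : IsLocalMax (fun t => x t - z t) t₀ := Eventually.of_forall ht₀
  have hd0 := hmax.hasDerivAt_eq_zero (hDd t₀)
  have heq : y t₀ - a * x t₀ = w t₀ - a * z t₀ := hψ.injective (by linarith)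
  -- the function `u` vanishes at `t₀` with positive derivative
  have hu : HasDerivAt (fun t => (y t - a * x t) - (w t - a * z t))
      ((h t₀ + K * x t₀ - a * ψ (y t₀ - a * x t₀))
        - (k t₀ + K * z t₀ - a * ψ (w t₀ - a * z t₀))) t₀ :=
    ((hy t₀).sub ((hx t₀).const_mul a)).sub ((hw t₀).sub ((hz t₀).const_mul a))
  have hupos : 0 < (h t₀ + K * x t₀ - a * ψ (y t₀ - a * x t₀))
        - (k t₀ + K * z t₀ - a * ψ (w t₀ - a * z t₀)) := by
    rw [heq]
    nlinarith [hhk t₀, mul_pos hK hpos]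
  have hev : ∀ᶠ t in 𝓝[>] t₀, 0 < (y t - a * x t) - (w t - a * z t) := by
    have h1 := (hasDerivAt_iff_tendsto_slope.1 hu).eventually (lt_mem_nhds hupos)
    have h2 : ∀ᶠ t in 𝓝[>] t₀, 0 < slope (fun t => (y t - a * x t) - (w t - a * z t)) t₀ t :=
      h1.filter_mono (nhdsWithin_mono _ (fun t ht => ne_of_gt ht))
    filter_upwards [h2, self_mem_nhdsWithin] with t ht htt
    have htt' : 0 < t - t₀ := sub_pos.2 htt
    rw [slope_def_field, heq, sub_self, sub_zero] at ht
    rcases div_pos_iff.1 ht with h3 | h3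
    · exact h3.1
    · linarith [h3.2]
  obtain ⟨t₂, ht₂, hIoo⟩ := mem_nhdsGT_iff_exists_Ioo_subset.1 hev
  have ht₂' : t₀ < t₂ := ht₂
  have hmono : StrictMonoOn (fun t => x t - z t) (Icc t₀ ((t₀ + t₂) / 2)) := by
    apply strictMonoOn_of_deriv_pos (convex_Icc _ _) hDc.continuousOn
    intro t ht
    rw [interior_Icc] at ht
    rw [(hDd t).deriv, sub_pos]
    apply hψ
    have : t ∈ Ioo t₀ t₂ := ⟨ht.1, by linarith [ht.2]⟩
    have := hIoo this
    simp only [Set.mem_ofPred_eq] at this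
    linarith
  have := hmono ⟨le_rfl, by linarith⟩ ⟨by linarith, le_rfl⟩ (show t₀ < (t₀ + t₂) / 2 by linarith)
  exact absurd (ht₀ ((t₀ + t₂) / 2)) (not_le.2 this)

/-- Existence between ordered lower and upper solutions, by monotone iteration. -/
lemma lower_upper {ψ : ℝ → ℝ} (hψ : StrictMono ψ) (hψ0 : ψ 0 = 0) (hlip : LipschitzWith 1 ψ)
    {c a b T : ℝ} (hc : 0 < c) (hψc : ∀ u, |ψ u| ≤ c) (ha : 0 < a) (hb : 0 < b) (hT : 0 < T)
    {p p₁ p₂ : ℝ → ℝ} (hpc : Continuous p) (hpp : Function.Periodic p T)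
    (hp₁ : ∀ t, p₁ t ≤ p t) (hp₂ : ∀ t, p t ≤ p₂ t)
    {α A β B : ℝ → ℝ} (hαp : Function.Periodic α T) (hβp : Function.Periodic β T)
    (hα : ∀ t, HasDerivAt α (ψ (A t - a * α t)) t)
    (hA : ∀ t, HasDerivAt A (p₂ t - b * Real.sin (α t)) t)
    (hβ : ∀ t, HasDerivAt β (ψ (B t - a * β t)) t)
    (hB : ∀ t, HasDerivAt B (p₁ t - b * Real.sin (β t)) t)
    (hαβ : ∀ t, α t ≤ β t) :
    ∃ x y : ℝ → ℝ, Function.Periodic x T ∧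
      (∀ t, HasDerivAt x (ψ (y t - a * x t)) t) ∧
      (∀ t, HasDerivAt y (p t - b * Real.sin (x t)) t) := by
  have hαc : Continuous α := continuous_iff_continuousAt.2 fun t => (hα t).continuousAt
  have hβc : Continuous β := continuous_iff_continuousAt.2 fun t => (hβ t).continuousAt
  have hex : ∀ x : {x : ℝ → ℝ // Continuous x ∧ Function.Periodic x T},
      ∃ x' : {x : ℝ → ℝ // Continuous x ∧ Function.Periodic x T}, ∃ y : ℝ → ℝ,
        Function.Periodic y T ∧ (∀ t, HasDerivAt x'.1 (ψ (y t - a * x'.1 t)) t) ∧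
        (∀ t, HasDerivAt y ((p t - b * Real.sin (x.1 t) - b * x.1 t) + b * x'.1 t) t) := by
    rintro ⟨x, hxc, hxp⟩
    obtain ⟨x', y, h1, h2, h3, h4⟩ := linv_exists hψ hψ0 hlip hc hψc ha hb hT
      (h := fun t => p t - b * Real.sin (x t) - b * x t) (by fun_prop)
      (by intro t; simp only [hpp t, hxp t])
    exact ⟨⟨x', continuous_iff_continuousAt.2 fun t => (h3 t).continuousAt, h1⟩, y, h2, h3, h4⟩
  choose nx Y hYp hnx hY using hex
  let s : ℕ → {x : ℝ → ℝ // Continuous x ∧ Function.Periodic x T} := fun n =>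
    nx^[n] ⟨α, hαc, hαp⟩
  obtain ⟨u, hu⟩ : ∃ u : ℕ → ℝ → ℝ, ∀ n, u n = (s n).1 := ⟨fun n => (s n).1, fun _ => rfl⟩
  obtain ⟨v, hv⟩ : ∃ v : ℕ → ℝ → ℝ, ∀ n, v n = Y (s n) := ⟨fun n => Y (s n), fun _ => rfl⟩
  have hs : ∀ n, s (n + 1) = nx (s n) := fun n => Function.iterate_succ_apply' _ _ _
  have hu0 : u 0 = α := by rw [hu]; rfl
  have huc : ∀ n, Continuous (u n) := fun n => by rw [hu]; exact (s n).2.1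
  have hup : ∀ n, Function.Periodic (u n) T := fun n => by rw [hu]; exact (s n).2.2
  have hvp : ∀ n, Function.Periodic (v n) T := fun n => by rw [hv]; exact hYp _
  have hud : ∀ n t, HasDerivAt (u (n + 1)) (ψ (v n t - a * u (n + 1) t)) t := by
    intro n t
    rw [hu (n + 1), hv n, hs]
    exact hnx (s n) t
  have hvd : ∀ n t, HasDerivAt (v n)
      ((p t - b * Real.sin (u n t) - b * u n t) + b * u (n + 1) t) t := by
    intro n t
    rw [hu (n + 1), hu n, hv n, hs]
    exact hY (s n) t
  clear_value s
  -- monotonicity of `r ↦ sin r + r`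
  have hmon : ∀ r q : ℝ, r ≤ q → b * Real.sin r + b * r ≤ b * Real.sin q + b * q := by
    intro r q hrq
    have h1 : |Real.sin q - Real.sin r| ≤ |q - r| := by
      have := Real.lipschitzWith_sin.dist_le_mul q r
      simpa [Real.dist_eq] using this
    rw [abs_of_nonneg (sub_nonneg.2 hrq)] at h1
    nlinarith [(abs_le.1 h1).1]
  have hinc : ∀ n t, u n t ≤ u (n + 1) t := by
    intro n
    induction n with
    | zero =>
      rw [hu0]
      refine max_principle hψ (K := b) (a := a) hb hT hαp (hup 1) hα
        (h := fun t => p₂ t - b * Real.sin (α t) - b * α t) (fun t => ?_)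
        (hud 0) (hvd 0) (fun t => ?_)
      · exact (hA t).congr_deriv (by ring)
      · rw [hu0]
        linarith [hp₂ t]
    | succ n ih =>
      refine max_principle hψ (K := b) (a := a) hb hT (hup (n + 1)) (hup (n + 2)) (hud n)
        (hvd n) (hud (n + 1)) (hvd (n + 1)) (fun t => ?_)
      linarith [hmon _ _ (ih t)]
  have hub : ∀ n t, u n t ≤ β t := by
    intro n
    induction n with
    | zero => rw [hu0]; exact hαβ
    | succ n ih =>
      refine max_principle hψ (K := b) (a := a) hb hT (hup (n + 1)) hβp (hud n) (hvd n) hβ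
        (k := fun t => p₁ t - b * Real.sin (β t) - b * β t) (fun t => ?_) (fun t => ?_)
      · exact (hB t).congr_deriv (by ring)
      · linarith [hmon _ _ (ih t), hp₁ t]
  have humono : ∀ t, Monotone (fun n => u n t) := fun t => monotone_nat_of_le_succ (hinc · t)
  have hlb : ∀ n t, α t ≤ u n t := by
    intro n t
    have := humono t (Nat.zero_le n)
    simpa only [hu0] using this
  -- limit
  obtain ⟨x, hx⟩ : ∃ x : ℝ → ℝ, ∀ t, Tendsto (fun n => u n t) atTop (𝓝 (x t)) := by
    refine ⟨fun t => ⨆ n, u n t, fun t => tendsto_atTop_ciSup (humono t) ⟨β t, ?_⟩⟩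
    rintro _ ⟨n, rfl⟩
    exact hub n t
  -- bounds
  obtain ⟨M₁, hM₁⟩ := periodic_bounded hT hαc hαp
  obtain ⟨M₂, hM₂⟩ := periodic_bounded hT hβc hβp
  obtain ⟨P, hP⟩ := periodic_bounded hT hpc hpp
  obtain ⟨M, hM⟩ : ∃ M, M = max M₁ M₂ := ⟨_, rfl⟩
  have huM : ∀ n t, |u n t| ≤ M := by
    intro n t
    rw [abs_le]
    have h1 := abs_le.1 (hM₁ t)
    have h2 := abs_le.1 (hM₂ t)
    have h3 : M₁ ≤ M := hM ▸ le_max_left _ _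
    have h4 : M₂ ≤ M := hM ▸ le_max_right _ _
    exact ⟨by linarith [hlb n t, h1.1], by linarith [hub n t, h2.2]⟩
  have hM0 : 0 ≤ M := (abs_nonneg _).trans (huM 0 0)
  have hP0 : 0 ≤ P := (abs_nonneg _).trans (hP 0)
  obtain ⟨D, hD⟩ : ∃ D, D = P + b + b * M + b * M := ⟨_, rfl⟩
  have hD0 : 0 ≤ D := by rw [hD]; positivity
  have hvD : ∀ n t, |(p t - b * Real.sin (u n t) - b * u n t) + b * u (n + 1) t| ≤ D := by
    intro n t
    have h1 := abs_le.1 (hP t)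
    have h2 := abs_le.1 (huM n t)
    have h3 := abs_le.1 (huM (n + 1) t)
    have h4 := Real.sin_le_one (u n t)
    have h5 := Real.neg_one_le_sin (u n t)
    rw [abs_le, hD]
    constructor <;> nlinarith
  have hv0 : ∀ n, v n 0 ∈ Icc (-(a * M + D * T)) (a * M + D * T) := by
    intro n
    obtain ⟨τ, hτ, hτ0⟩ := exists_hasDerivAt_eq_zero hT (huc (n + 1)).continuousOn
      (by have := hup (n + 1) 0; rw [zero_add] at this; exact this.symm)
      (fun t _ => hud n t)
    have h1 : v n τ - a * u (n + 1) τ = 0 := hψ.injective (by rw [hτ0, hψ0])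
    have h2 := abs_le.1 (mvt_bound hD0 (fun t (_ : t ∈ Icc 0 T) => hvd n t)
      (fun t _ => hvD n t) τ ⟨hτ.1.le, hτ.2.le⟩)
    have h3 := abs_le.1 (huM (n + 1) τ)
    constructor <;> nlinarith
  obtain ⟨η, _, σ, hσ, hη⟩ := isCompact_Icc.tendsto_subseq hv0
  have hxσ : ∀ t, Tendsto (fun n => u (σ n) t) atTop (𝓝 (x t)) := fun t =>
    (hx t).comp hσ.tendsto_atTop
  have hxσ1 : ∀ t, Tendsto (fun n => u (σ n + 1) t) atTop (𝓝 (x t)) := fun t =>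
    ((hx t).comp (tendsto_add_atTop_nat 1)).comp hσ.tendsto_atTop
  have hvc : ∀ n, Continuous (v n) := fun n =>
    continuous_iff_continuousAt.2 fun t => (hvd n t).continuousAt
  -- continuity of the limit
  have hxc : Continuous x := by
    have hul : ∀ n, LipschitzWith (Real.toNNReal c) (u (n + 1)) := by
      intro n
      apply lipschitzWith_of_nnnorm_deriv_le (fun t => (hud n t).differentiableAt)
      intro t
      rw [(hud n t).deriv, ← NNReal.coe_le_coe, coe_nnnorm, Real.norm_eq_abs,
        Real.coe_toNNReal _ hc.le]
      exact hψc _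
    have : LipschitzWith (Real.toNNReal c) x := by
      apply LipschitzWith.of_dist_le_mul
      intro t r
      exact le_of_tendsto' ((hxσ1 t).dist (hxσ1 r)) (fun n => (hul (σ n)).dist_le_mul t r)
    exact this.continuous
  have hxp : Function.Periodic x T := by
    intro t
    refine tendsto_nhds_unique (hx (t + T)) ?_
    simp only [hup _ t]
    exact hx t
  obtain ⟨y, hy⟩ : ∃ y : ℝ → ℝ, ∀ t, y t = η + ∫ τ in (0 : ℝ)..t, (p τ - b * Real.sin (x τ)) :=
    ⟨_, fun _ => rfl⟩
  have hyd : ∀ t, HasDerivAt y (p t - b * Real.sin (x t)) t := by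
    intro t
    have hcn : Continuous (fun τ => p τ - b * Real.sin (x τ)) := by fun_prop
    have : y = fun t => η + ∫ τ in (0 : ℝ)..t, (p τ - b * Real.sin (x τ)) := funext hy
    rw [this]
    exact (hcn.integral_hasStrictDerivAt 0 t).hasDerivAt.const_add _
  have hyc : Continuous y := continuous_iff_continuousAt.2 fun t => (hyd t).continuousAt
  have hvlim : ∀ t, Tendsto (fun n => v (σ n) t) atTop (𝓝 (y t)) := by
    intro t
    have h1 : ∀ n, v (σ n) t = v (σ n) 0 + ∫ τ in (0 : ℝ)..t,
        ((p τ - b * Real.sin (u (σ n) τ) - b * u (σ n) τ) + b * u (σ n + 1) τ) := by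
      intro n
      rw [intervalIntegral.integral_eq_sub_of_hasDerivAt (fun τ _ => hvd (σ n) τ)]
      · ring
      · apply Continuous.intervalIntegrable
        have := huc (σ n)
        have := huc (σ n + 1)
        fun_prop
    simp only [h1]
    rw [hy]
    refine Tendsto.add hη ?_
    refine intervalIntegral.tendsto_integral_filter_of_dominated_convergence (fun _ => D)
      (Eventually.of_forall fun n => ?_) (Eventually.of_forall fun n => ?_) ?_ ?_
    · apply Continuous.aestronglyMeasurable
      have := huc (σ n)
      have := huc (σ n + 1)
      fun_prop
    · exact Eventually.of_forall fun τ _ => hvD (σ n) τ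
    · exact intervalIntegrable_const
    · refine Eventually.of_forall fun τ _ => ?_
      have h2 : p τ - b * Real.sin (x τ)
          = (p τ - b * Real.sin (x τ) - b * x τ) + b * x τ := by ring
      rw [h2]
      have h3 := (Real.continuous_sin.tendsto (x τ)).comp (hxσ τ)
      exact ((tendsto_const_nhds.sub (h3.const_mul b)).sub ((hxσ τ).const_mul b)).add
        ((hxσ1 τ).const_mul b)
  have hψcont := hlip.continuous
  have hxint : ∀ t, x t = x 0 + ∫ τ in (0 : ℝ)..t, ψ (y τ - a * x τ) := by
    intro t
    refine tendsto_nhds_unique (hxσ1 t) ?_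
    have h1 : ∀ n, u (σ n + 1) t = u (σ n + 1) 0 + ∫ τ in (0 : ℝ)..t,
        ψ (v (σ n) τ - a * u (σ n + 1) τ) := by
      intro n
      rw [intervalIntegral.integral_eq_sub_of_hasDerivAt (fun τ _ => hud (σ n) τ)]
      · ring
      · apply Continuous.intervalIntegrable
        have := hvc (σ n)
        have := huc (σ n + 1)
        fun_prop
    simp only [h1]
    refine Tendsto.add (hxσ1 0) ?_
    refine intervalIntegral.tendsto_integral_filter_of_dominated_convergence (fun _ => c)
      (Eventually.of_forall fun n => ?_) (Eventually.of_forall fun n => ?_) ?_ ?_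
    · apply Continuous.aestronglyMeasurable
      have := hvc (σ n)
      have := huc (σ n + 1)
      fun_prop
    · exact Eventually.of_forall fun τ _ => hψc _
    · exact intervalIntegrable_const
    · refine Eventually.of_forall fun τ _ => ?_
      exact (hψcont.tendsto _).comp ((hvlim τ).sub ((hxσ1 τ).const_mul a))
  refine ⟨x, y, hxp, fun t => ?_, hyd⟩
  have hcn : Continuous (fun τ => ψ (y τ - a * x τ)) := by fun_prop
  have h1 := (hcn.integral_hasStrictDerivAt 0 t).hasDerivAt.const_add (x 0)
  exact h1.congr_of_eventuallyEq (Eventually.of_forall hxint)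

/-- A periodic solution yields a solution of the first order system. -/
lemma IsPendSol.system {c a b T : ℝ} (hc : 0 < c) {p x : ℝ → ℝ} (h : IsPendSol c a b T p x) :
    ∃ y : ℝ → ℝ, (∀ t, HasDerivAt x (psi c (y t - a * x t)) t) ∧
      (∀ t, HasDerivAt y (p t - b * Real.sin (x t)) t) := by
  obtain ⟨_, hx, hlt, hphi, heq⟩ := h
  have hxd : ∀ t, HasDerivAt x (deriv x t) t := fun t =>
    (hx.differentiable one_ne_zero t).hasDerivAt
  refine ⟨fun t => phi c (deriv x t) + a * x t, fun t => ?_, fun t => ?_⟩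
  · simp only [add_sub_cancel_right]
    rw [psi_phi hc (hlt t)]
    exact hxd t
  · have h1 := (hphi.differentiable one_ne_zero t).hasDerivAt.add ((hxd t).const_mul a)
    exact h1.congr_deriv (by linarith [heq t])

lemma IsPendSol.of_system {c a b T : ℝ} (hc : 0 < c) {p x y : ℝ → ℝ} (hp : Continuous p)
    (hxp : Function.Periodic x T) (hx : ∀ t, HasDerivAt x (psi c (y t - a * x t)) t)
    (hy : ∀ t, HasDerivAt y (p t - b * Real.sin (x t)) t) : IsPendSol c a b T p x := by
  have hdx : deriv x = fun t => psi c (y t - a * x t) := funext fun t => (hx t).deriv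
  have hxc : Continuous x := continuous_iff_continuousAt.2 fun t => (hx t).continuousAt
  have hyc : Continuous y := continuous_iff_continuousAt.2 fun t => (hy t).continuousAt
  have hψ := (psi_lipschitz c).continuous
  have hphi : (fun t => phi c (deriv x t)) = fun t => y t - a * x t := by
    rw [hdx]
    funext t
    exact phi_psi hc _
  have hd : ∀ t, HasDerivAt (fun t => y t - a * x t)
      (p t - b * Real.sin (x t) - a * psi c (y t - a * x t)) t := fun t =>
    (hy t).sub ((hx t).const_mul a)
  refine ⟨hxp, ?_, ?_, ?_, ?_⟩
  · rw [contDiff_one_iff_deriv]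
    refine ⟨fun t => (hx t).differentiableAt, ?_⟩
    rw [hdx]
    fun_prop
  · intro t
    rw [hdx]
    exact psi_abs_lt hc _
  · rw [hphi, contDiff_one_iff_deriv]
    refine ⟨fun t => (hd t).differentiableAt, ?_⟩
    have : deriv (fun t => y t - a * x t) = fun t =>
      p t - b * Real.sin (x t) - a * psi c (y t - a * x t) := funext fun t => (hd t).deriv
    rw [this]
    fun_prop
  · intro t
    rw [hphi, (hd t).deriv, hdx]
    ring

/-- the solvability set is connected, hence an interval. -/
theorem solvSet_connected (c a b T : ℝ) (hc : 0 < c) (ha : 0 < a) (hb : 0 < b) (hT : 0 < T)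
    (p₀ : ℝ → ℝ) (hp₀cont : Continuous p₀) (hp₀per : Function.Periodic p₀ T)
    (hp₀avg : (∫ t in (0:ℝ)..T, p₀ t) = 0) :
    (∀ s₁ ∈ solvSet c a b T p₀, ∀ s₂ ∈ solvSet c a b T p₀,
      ∀ s : ℝ, s₁ < s → s < s₂ → s ∈ solvSet c a b T p₀) ∧
    (solvSet c a b T p₀).OrdConnected := by
  have main : ∀ s₁ ∈ solvSet c a b T p₀, ∀ s₂ ∈ solvSet c a b T p₀,
      ∀ s : ℝ, s₁ < s → s < s₂ → s ∈ solvSet c a b T p₀ := by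
    rintro s₁ ⟨β, hβ⟩ s₂ ⟨α, hα⟩ s h1 h2
    obtain ⟨B, hβd, hBd⟩ := hβ.system hc
    obtain ⟨A, hαd, hAd⟩ := hα.system hc
    obtain ⟨M₁, hM₁⟩ := periodic_bounded hT hα.2.1.continuous hα.1
    obtain ⟨M₂, hM₂⟩ := periodic_bounded hT hβ.2.1.continuous hβ.1
    -- shift the upper solution by a multiple of the period of the sine
    obtain ⟨k, hk⟩ := exists_nat_ge ((M₁ + M₂) / (2 * π))
    rw [div_le_iff₀ (by positivity)] at hk
    obtain ⟨x, y, hxp, hx, hy⟩ := lower_upper (psi_strictMono c) (psi_zero c) (psi_lipschitz c)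
      hc (fun u => (psi_abs_lt hc u).le) ha hb hT (p := fun t => p₀ t + s)
      (p₁ := fun t => p₀ t + s₁) (p₂ := fun t => p₀ t + s₂)
      (hp₀cont.add continuous_const) (by intro t; simp only [hp₀per t])
      (fun t => by linarith) (fun t => by linarith)
      (α := α) (A := A) (β := fun t => β t + k * (2 * π)) (B := fun t => B t + a * (k * (2 * π)))
      hα.1 (by intro t; simp only [hβ.1 t]) hαd hAd
      (fun t => ((hβd t).add_const _).congr_deriv (by congr 1; ring))
      (fun t => ((hBd t).add_const _).congr_deriv (by rw [Real.sin_add_nat_mul_two_pi]))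
      (fun t => by
        have h3 := abs_le.1 (hM₁ t)
        have h4 := abs_le.1 (hM₂ t)
        linarith [h3.2, h4.1])
    exact ⟨x, IsPendSol.of_system hc (hp₀cont.add continuous_const) hxp hx hy⟩
  refine ⟨main, ⟨?_⟩⟩
  intro s₁ hs₁ s₂ hs₂ s hs
  rcases hs.1.eq_or_lt with he | hl
  · exact he ▸ hs₁
  rcases hs.2.eq_or_lt with he | hl'
  · exact he ▸ hs₂
  exact main s₁ hs₁ s₂ hs₂ s hl hl'
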